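/- arXiv:1410.2113 — 5 statements merged into one kernel-verified Lean document; each statement's English description precedes it below -/
import Mathlib

section
/- Let $d \ge 1$, let $\alpha > d/2$ be a non-integer real number, let $\kappa > 0$, and let $a_0 = 1$, $a_k = \alpha(\alpha-1)\cdots(\alpha-k+1)/k!$ for $k \ge 1$. Then for every integer $J \ge 1$, setting $K = \lfloor\alpha\rfloor + 2J + 1$, there exists a constant $c > 0$ independent of $J$ such that $c\,(1 + |\xi|^{d+2}) \le \sum_{k=0}^{K} a_k\, \kappa^{2(\alpha-k)}\, |\xi|^{2k}$ for all $\xi \in \mathbb{R}^d$. -/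
open Filter MeasureTheory

/-- Generalized binomial coefficients: `a α 0 = 1`,
`a α k = α (α-1) ⋯ (α-k+1) / k!` for `k ≥ 1`. -/
noncomputable def a (α : ℝ) (k : ℕ) : ℝ :=
  (∏ i ∈ Finset.range k, (α - i)) / (Nat.factorial k : ℝ)

/-- The partial sum of order `N` of the binomial series of `(1 + t) ^ α`. -/
noncomputable def binomialPartialSum (α : ℝ) (N : ℕ) (t : ℝ) : ℝ :=
  ∑ k ∈ Finset.range N, a α k * t ^ k

lemma a_zero (α : ℝ) : a α 0 = 1 := by simp [a]

lemma succ_mul_a_succ (α : ℝ) (k : ℕ) : ((k : ℝ) + 1) * a α (k + 1) = (α - k) * a α k := by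
  have h1 : ((k : ℝ) + 1) ≠ 0 := by positivity
  have h2 : (Nat.factorial k : ℝ) ≠ 0 := by positivity
  unfold a
  rw [Finset.prod_range_succ, Nat.factorial_succ]
  push_cast
  field_simp

lemma a_pos_of_le {α : ℝ} {n : ℕ} (hn : (n : ℝ) < α) {k : ℕ} (hk : k ≤ n + 1) : 0 < a α k := by
  refine div_pos (Finset.prod_pos fun i hi => ?_) (by positivity)
  have hi' : i ≤ n := by have := Finset.mem_range.mp hi; omega
  have : (i : ℝ) ≤ n := by exact_mod_cast hi'
  linarith

/-- Beyond the index `n + 1`, where `n < α < n + 1`, the coefficients alternate in sign. -/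
lemma neg_one_pow_mul_a_pos {α : ℝ} {n : ℕ} (hn : (n : ℝ) < α) (hn' : α < n + 1) (j : ℕ) :
    0 < (-1) ^ j * a α (n + 1 + j) := by
  induction j with
  | zero => simpa using a_pos_of_le hn le_rfl
  | succ j ih =>
    have h := succ_mul_a_succ α (n + 1 + j)
    push_cast at h
    have hpos : 0 < (n : ℝ) + 1 + j - α := by
      have : (0 : ℝ) ≤ j := by positivity
      linarith
    have key : ((n : ℝ) + 1 + j + 1) * ((-1) ^ (j + 1) * a α (n + 1 + (j + 1))) =
        ((n : ℝ) + 1 + j - α) * ((-1) ^ j * a α (n + 1 + j)) := by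
      rw [← add_assoc (n + 1) j 1, pow_succ]
      linear_combination (-(-1) ^ j) * h
    exact pos_of_mul_pos_right (key ▸ mul_pos hpos ih) (by positivity)

lemma a_neg_of_odd {α : ℝ} {n : ℕ} (hn : (n : ℝ) < α) (hn' : α < n + 1) (j : ℕ) :
    a α (n + 2 * j + 2) < 0 := by
  have h := neg_one_pow_mul_a_pos hn hn' (2 * j + 1)
  rw [pow_succ, pow_mul, show n + 1 + (2 * j + 1) = n + 2 * j + 2 by ring] at h
  norm_num at h
  exact h

lemma a_pos_of_even {α : ℝ} {n : ℕ} (hn : (n : ℝ) < α) (hn' : α < n + 1) (j : ℕ) :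
    0 < a α (n + 2 * j + 3) := by
  have h := neg_one_pow_mul_a_pos hn hn' (2 * (j + 1))
  rw [pow_mul, show n + 1 + 2 * (j + 1) = n + 2 * j + 3 by ring] at h
  norm_num at h
  exact h

/-- The differential equation `(1 + t) P' = α P` satisfied by the partial sums up to a
remainder. -/
lemma one_add_mul_deriv_binomialPartialSum (α : ℝ) (N : ℕ) (t : ℝ) :
    (1 + t) * (∑ k ∈ Finset.range N, a α k * (k * t ^ (k - 1))) -
      α * binomialPartialSum α N t = -(N * a α N * t ^ (N - 1)) := by
  unfold binomialPartialSum
  induction N with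
  | zero => simp
  | succ N ih =>
    rw [Finset.sum_range_succ, Finset.sum_range_succ]
    have h := succ_mul_a_succ α N
    have ht : (N : ℝ) * t ^ (N - 1) * t = N * t ^ N := by
      cases N with
      | zero => simp
      | succ m => rw [Nat.add_sub_cancel, pow_succ]; ring
    push_cast
    linear_combination ih + a α N * ht + t ^ N * h

lemma hasDerivAt_binomialPartialSum (α : ℝ) (N : ℕ) (t : ℝ) :
    HasDerivAt (binomialPartialSum α N)
      (∑ k ∈ Finset.range N, a α k * (k * t ^ (k - 1))) t := by
  unfold binomialPartialSum
  exact HasDerivAt.fun_sum fun k _ => (hasDerivAt_pow k t).const_mul (a α k)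

/-- If the first omitted coefficient is nonpositive, the partial sum dominates
`(1 + t) ^ α`. -/
lemma one_add_rpow_le_binomialPartialSum {α : ℝ} {N : ℕ} (hN : 0 < N) (haN : a α N ≤ 0) {t : ℝ}
    (ht : 0 ≤ t) : (1 + t) ^ α ≤ binomialPartialSum α N t := by
  have hderiv : ∀ s : ℝ, 0 ≤ s → HasDerivAt (fun s => binomialPartialSum α N s * (1 + s) ^ (-α))
      ((1 + s) ^ (-α - 1) * -(N * a α N * s ^ (N - 1))) s := by
    intro s hs
    have hs1 : 0 < 1 + s := by linarith
    have h1 : HasDerivAt (fun s : ℝ => (1 + s) ^ (-α)) (1 * (-α) * (1 + s) ^ (-α - 1)) s :=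
      ((hasDerivAt_id s).const_add 1).rpow_const (Or.inl hs1.ne')
    refine ((hasDerivAt_binomialPartialSum α N s).mul h1).congr_deriv ?_
    have h2 : (1 + s) ^ (-α) = (1 + s) ^ (-α - 1) * (1 + s) := by
      rw [← Real.rpow_add_one hs1.ne']; ring_nf
    rw [← one_add_mul_deriv_binomialPartialSum, h2]
    ring
  have hmono : MonotoneOn (fun s => binomialPartialSum α N s * (1 + s) ^ (-α)) (Set.Ici 0) := by
    refine monotoneOn_of_deriv_nonneg (convex_Ici 0)
      (fun s hs => (hderiv s hs).continuousAt.continuousWithinAt)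
      (fun s hs => (hderiv s (interior_subset hs)).differentiableAt.differentiableWithinAt)
      fun s hs => ?_
    have hs0 : (0 : ℝ) ≤ s := interior_subset hs
    rw [(hderiv s hs0).deriv]
    refine mul_nonneg (by positivity) (neg_nonneg.mpr ?_)
    exact mul_nonpos_of_nonpos_of_nonneg
      (mul_nonpos_of_nonneg_of_nonpos (by positivity) haN) (by positivity)
  have h := hmono Set.self_mem_Ici (Set.mem_Ici.mpr ht) ht
  have h0 : binomialPartialSum α N 0 = 1 := by
    obtain ⟨m, rfl⟩ := Nat.exists_eq_succ_of_ne_zero hN.ne'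
    simp [binomialPartialSum, Finset.sum_range_succ', a_zero]
  have hp : 0 < (1 + t) ^ α := by positivity
  simp only [h0, add_zero, Real.one_rpow, mul_one] at h
  rw [Real.rpow_neg (by linarith), ← div_eq_mul_inv, le_div_iff₀ hp] at h
  linarith

/-- For large `t` a negative term is absorbed by half of the positive term that follows it. -/
lemma half_mul_le_add_of_neg {α : ℝ} (hα : 0 < α) {N : ℕ} (hN : α + 1 ≤ N) (haN : a α N < 0)
    {t : ℝ} (ht : 2 * (2 + α) ≤ t) :
    a α (N + 1) / 2 * t ^ (N + 1) ≤ a α N * t ^ N + a α (N + 1) * t ^ (N + 1) := by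
  have ht0 : 0 < t := by linarith
  have h := succ_mul_a_succ α N
  have h1 : (0 : ℝ) < N + 1 := by positivity
  have h2 : 2 * ((N : ℝ) + 1) ≤ (N - α) * t := by
    nlinarith [mul_nonneg (sub_nonneg.mpr hN) hα.le,
      mul_le_mul_of_nonneg_left ht (by linarith : (0 : ℝ) ≤ N - α)]
  have h3 : 0 ≤ 2 * a α N + a α (N + 1) * t := by
    refine nonneg_of_mul_nonneg_right (a := (N : ℝ) + 1) ?_ h1
    have : ((N : ℝ) + 1) * (2 * a α N + a α (N + 1) * t) =
        (-a α N) * ((N - α) * t - 2 * (N + 1)) := by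
      linear_combination t * h
    rw [this]
    exact mul_nonneg (by linarith) (by linarith)
  have h4 : 0 ≤ t ^ N * (2 * a α N + a α (N + 1) * t) := mul_nonneg (by positivity) h3
  rw [pow_succ]
  linarith

lemma one_le_binomialPartialSum_add_two {α : ℝ} {n : ℕ} (hn : (n : ℝ) < α) {t : ℝ}
    (ht : 0 ≤ t) : 1 ≤ binomialPartialSum α (n + 2) t := by
  rw [binomialPartialSum, Finset.sum_range_succ', a_zero, pow_zero, mul_one]
  refine le_add_of_nonneg_left (Finset.sum_nonneg fun k hk => ?_)
  have hk' := Finset.mem_range.mp hk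
  exact mul_nonneg (a_pos_of_le hn (by omega)).le (by positivity)

lemma one_add_mul_pow_le_binomialPartialSum {α : ℝ} {n : ℕ} (hn : (n : ℝ) < α)
    (hn' : α < n + 1) {t : ℝ} (ht : 2 * (2 + α) ≤ t) (j : ℕ) :
    1 + a α (n + 3) / 2 * t ^ (n + 3) ≤ binomialPartialSum α (n + 2 * (j + 1) + 2) t := by
  have hα : 0 < α := lt_of_le_of_lt (Nat.cast_nonneg n) hn
  have ht0 : 0 ≤ t := by linarith
  have step : ∀ i : ℕ, binomialPartialSum α (n + 2 * i + 2) t +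
      a α (n + 2 * i + 3) / 2 * t ^ (n + 2 * i + 3) ≤
        binomialPartialSum α (n + 2 * (i + 1) + 2) t := by
    intro i
    have h := half_mul_le_add_of_neg hα (N := n + 2 * i + 2)
      (by push_cast; linarith [(Nat.cast_nonneg i : (0 : ℝ) ≤ i)]) (a_neg_of_odd hn hn' i) ht
    rw [show n + 2 * (i + 1) + 2 = n + 2 * i + 2 + 1 + 1 by ring]
    unfold binomialPartialSum
    rw [Finset.sum_range_succ _ (n + 2 * i + 2 + 1), Finset.sum_range_succ _ (n + 2 * i + 2)]
    linarith
  induction j with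
  | zero =>
    have h := step 0
    have h1 := one_le_binomialPartialSum_add_two hn ht0
    simp only [mul_zero, add_zero] at h
    linarith
  | succ j ih =>
    have h := step (j + 1)
    have : 0 ≤ a α (n + 2 * (j + 1) + 3) / 2 * t ^ (n + 2 * (j + 1) + 3) :=
      mul_nonneg (by linarith [a_pos_of_even hn hn' (j + 1)]) (by positivity)
    linarith

/-- The partial sums ending in a positive term beyond the index `n + 1` are bounded below,
uniformly in their length, by a multiple of `1 + t ^ (n + 3)`. -/
lemma exists_mul_one_add_pow_le_binomialPartialSum {α : ℝ} {n : ℕ} (hn : (n : ℝ) < α)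
    (hn' : α < n + 1) :
    ∃ c : ℝ, 0 < c ∧ ∀ j : ℕ, ∀ t : ℝ, 0 ≤ t →
      c * (1 + t ^ (n + 3)) ≤ binomialPartialSum α (n + 2 * (j + 1) + 2) t := by
  have hα : 0 < α := lt_of_le_of_lt (Nat.cast_nonneg n) hn
  have hb : 0 < a α (n + 3) / 2 := half_pos (a_pos_of_even hn hn' 0)
  set T : ℝ := 2 * (2 + α) with hT
  have hT0 : 0 < T := by positivity
  have hTp : 0 < T ^ (n + 3) := by positivity
  refine ⟨min (a α (n + 3) / 2) (1 / (1 + T ^ (n + 3))), lt_min hb (by positivity), ?_⟩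
  intro j t ht
  have htp : 0 ≤ t ^ (n + 3) := by positivity
  have hc := min_le_right (a α (n + 3) / 2) (1 / (1 + T ^ (n + 3)))
  rcases le_total T t with hTt | hTt
  · have h1 : 1 / (1 + T ^ (n + 3)) ≤ 1 := by
      rw [div_le_one (by positivity)]; linarith
    have h2 := mul_le_mul_of_nonneg_right
      (min_le_left (a α (n + 3) / 2) (1 / (1 + T ^ (n + 3)))) htp
    linarith [one_add_mul_pow_le_binomialPartialSum hn hn' hTt j]
  · have h1 : (1 : ℝ) ≤ binomialPartialSum α (n + 2 * (j + 1) + 2) t :=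
      (Real.one_le_rpow (by linarith) hα.le).trans
        (one_add_rpow_le_binomialPartialSum (by omega) (a_neg_of_odd hn hn' (j + 1)).le ht)
    refine le_trans ?_ h1
    calc _ ≤ 1 / (1 + T ^ (n + 3)) * (1 + T ^ (n + 3)) := by gcongr
      _ = 1 := by field_simp

lemma one_add_pow_le_two_mul {s : ℝ} (hs : 0 ≤ s) {p q : ℕ} (hpq : p ≤ q) :
    1 + s ^ p ≤ 2 * (1 + s ^ q) := by
  have hq : 0 ≤ s ^ q := by positivity
  rcases le_total s 1 with h | h
  · linarith [pow_le_one₀ hs h (n := p)]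
  · linarith [pow_le_pow_right₀ h hpq]

/-- For non-integer `α > d/2`, `κ > 0` and truncation levels `K = ⌊α⌋ + 2J + 1`,
the truncated Taylor polynomial of `(κ² + |ξ|²)^α` admits a lower bound
`c (1 + |ξ|^{d+2})` with `c > 0` independent of `J`. -/
theorem stmt_0 (d : ℕ) (hd : 1 ≤ d) (α : ℝ) (hα : (d : ℝ) / 2 < α)
    (hαni : ∀ n : ℤ, α ≠ (n : ℝ)) (κ : ℝ) (hκ : 0 < κ) :
    ∃ c : ℝ, 0 < c ∧ ∀ J : ℕ, 1 ≤ J → ∀ ξ : EuclideanSpace ℝ (Fin d),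
      c * (1 + ‖ξ‖ ^ (d + 2)) ≤
        ∑ k ∈ Finset.range (⌊α⌋₊ + 2 * J + 1 + 1),
          a α k * κ ^ (2 * (α - (k : ℝ))) * ‖ξ‖ ^ (2 * k) := by
  have hα0 : 0 < α := lt_of_le_of_lt (by positivity) hα
  have hn : ((⌊α⌋₊ : ℕ) : ℝ) < α :=
    lt_of_le_of_ne (Nat.floor_le hα0.le) fun h => hαni ⌊α⌋₊ (by exact_mod_cast h.symm)
  have hn' : α < (⌊α⌋₊ : ℝ) + 1 := Nat.lt_floor_add_one α
  generalize ⌊α⌋₊ = n at hn hn' ⊢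
  obtain ⟨c, hc, hbound⟩ := exists_mul_one_add_pow_le_binomialPartialSum hn hn'
  have hdeg : d + 2 ≤ 2 * (n + 3) := by
    have : (d : ℝ) < 2 * n + 2 := by linarith
    have : d < 2 * n + 2 := by exact_mod_cast this
    omega
  have hκα : 0 < κ ^ (2 * α) := by positivity
  refine ⟨κ ^ (2 * α) * (c / (2 * (1 + κ ^ (d + 2)))), by positivity, fun J hJ ξ => ?_⟩
  obtain ⟨j, rfl⟩ := Nat.exists_eq_add_of_le' hJ
  set s : ℝ := ‖ξ‖ / κ with hs
  have hs0 : 0 ≤ s := by positivity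
  have hξ : ‖ξ‖ = κ * s := by rw [hs]; field_simp
  have hsum : ∑ k ∈ Finset.range (n + 2 * (j + 1) + 1 + 1),
      a α k * κ ^ (2 * (α - (k : ℝ))) * ‖ξ‖ ^ (2 * k) =
        κ ^ (2 * α) * binomialPartialSum α (n + 2 * (j + 1) + 2) (s ^ 2) := by
    rw [binomialPartialSum, Finset.mul_sum]
    refine Finset.sum_congr rfl fun k _ => ?_
    have hκk : κ ^ (2 * (α - (k : ℝ))) = κ ^ (2 * α) / κ ^ (2 * k) := by
      rw [← Real.rpow_natCast κ (2 * k), ← Real.rpow_sub hκ]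
      push_cast
      ring_nf
    rw [hκk, hξ, mul_pow, ← pow_mul]
    field_simp
  rw [hsum, mul_assoc]
  refine mul_le_mul_of_nonneg_left (le_trans ?_ (hbound j (s ^ 2) (by positivity))) hκα.le
  have h1 : 1 + ‖ξ‖ ^ (d + 2) ≤ (1 + κ ^ (d + 2)) * (1 + s ^ (d + 2)) := by
    rw [hξ, mul_pow]
    have : 0 ≤ κ ^ (d + 2) := by positivity
    have : 0 ≤ s ^ (d + 2) := by positivity
    linarith
  have h2 := one_add_pow_le_two_mul hs0 hdeg
  rw [← pow_mul]
  calc c / (2 * (1 + κ ^ (d + 2))) * (1 + ‖ξ‖ ^ (d + 2))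
      ≤ c / (2 * (1 + κ ^ (d + 2))) *
          ((1 + κ ^ (d + 2)) * (2 * (1 + s ^ (2 * (n + 3))))) := by
        refine mul_le_mul_of_nonneg_left (h1.trans ?_) (by positivity)
        exact mul_le_mul_of_nonneg_left h2 (by positivity)
    _ = c * (1 + s ^ (2 * (n + 3))) := by field_simp
end

section
/- Let $\alpha > 0$ be a non-integer real number and let $a_0 = 1$, $a_k = \alpha(\alpha-1)\cdots(\alpha-k+1)/k!$ for $k \ge 1$. Define $q_0(t) = \sum_{k=0}^{\lfloor\alpha\rfloor} a_k t^{2k} + \tfrac{1}{2} a_{\lfloor\alpha\rfloor+1}\, t^{2(\lfloor\alpha\rfloor+1)}$. Then for every integer $m \ge d + 2$ with $m \le 2(\lfloor\alpha\rfloor+1)$ there exists a constant $c > 0$ such that $q_0(t) \ge c\,(1 + t^{d+2})$ for all $t \ge 0$, where $d \ge 1$ is any integer with $\alpha > d/2$. -/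
open Filter MeasureTheory

/-- `q₀(t) = ∑_{k=0}^{⌊α⌋} a_k t^{2k} + (1/2) a_{⌊α⌋+1} t^{2(⌊α⌋+1)}`. -/
noncomputable def q0 (α : ℝ) (t : ℝ) : ℝ :=
  (∑ k ∈ Finset.range (⌊α⌋₊ + 1), a α k * t ^ (2 * k)) +
    (1 / 2) * a α (⌊α⌋₊ + 1) * t ^ (2 * (⌊α⌋₊ + 1))

/-- All generalized binomial coefficients up to index `⌊α⌋ + 1` are positive. -/
theorem a_pos {α : ℝ} (hα : (⌊α⌋₊ : ℝ) < α) {k : ℕ} (hk : k ≤ ⌊α⌋₊ + 1) : 0 < a α k := by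
  refine div_pos (Finset.prod_pos fun i hi => ?_) (by positivity)
  have hik : i ≤ ⌊α⌋₊ := by
    have := Finset.mem_range.mp hi
    omega
  have : (i : ℝ) ≤ ⌊α⌋₊ := by exact_mod_cast hik
  linarith

/-- On `t ≥ 0`, `q0` dominates its constant term plus its leading term. -/
theorem one_add_le_q0 {α : ℝ} (hα : (⌊α⌋₊ : ℝ) < α) {t : ℝ} (ht : 0 ≤ t) :
    1 + (1 / 2) * a α (⌊α⌋₊ + 1) * t ^ (2 * (⌊α⌋₊ + 1)) ≤ q0 α t := by
  have h := Finset.single_le_sum (s := Finset.range (⌊α⌋₊ + 1))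
    (f := fun k => a α k * t ^ (2 * k))
    (fun k hk => mul_nonneg (a_pos hα (Finset.mem_range.mp hk).le).le (pow_nonneg ht _))
    (Finset.mem_range.mpr (Nat.succ_pos _))
  have h0 : a α 0 * t ^ (2 * 0) = 1 := by simp [a]
  unfold q0
  linarith

theorem pow_le_one_add_pow {t : ℝ} (ht : 0 ≤ t) {k n : ℕ} (hkn : k ≤ n) :
    t ^ k ≤ 1 + t ^ n := by
  rcases le_total t 1 with h | h
  · linarith [pow_le_one₀ (n := k) ht h, pow_nonneg ht n]
  · linarith [pow_le_pow_right₀ h hkn]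

/-- For every integer `m` with `d + 2 ≤ m ≤ 2(⌊α⌋+1)` there is `c > 0` with
`q₀(t) ≥ c (1 + t^{d+2})` for all `t ≥ 0`, where `d ≥ 1` satisfies `α > d/2`. -/
theorem stmt_1 (α : ℝ) (hα0 : 0 < α) (hαni : ∀ n : ℤ, α ≠ (n : ℝ))
    (d : ℕ) (hd : 1 ≤ d) (hαd : (d : ℝ) / 2 < α)
    (m : ℕ) (hm1 : d + 2 ≤ m) (hm2 : m ≤ 2 * (⌊α⌋₊ + 1)) :
    ∃ c : ℝ, 0 < c ∧ ∀ t : ℝ, 0 ≤ t → c * (1 + t ^ (d + 2)) ≤ q0 α t := by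
  have hα : (⌊α⌋₊ : ℝ) < α :=
    lt_of_le_of_ne (Nat.floor_le hα0.le) fun h => hαni ⌊α⌋₊ (by exact_mod_cast h.symm)
  have hb : 0 < (1 / 2) * a α (⌊α⌋₊ + 1) := mul_pos one_half_pos (a_pos hα le_rfl)
  set b := (1 / 2) * a α (⌊α⌋₊ + 1) with hb_def
  have hc : 0 < min (1 / 2) b := lt_min one_half_pos hb
  refine ⟨min (1 / 2) b, hc, fun t ht => ?_⟩
  have hpow := pow_le_one_add_pow ht (hm1.trans hm2)
  have hq := one_add_le_q0 hα ht
  rw [← hb_def] at hq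
  have hT : 0 ≤ t ^ (2 * (⌊α⌋₊ + 1)) := pow_nonneg ht _
  calc min (1 / 2) b * (1 + t ^ (d + 2))
      ≤ min (1 / 2) b * (2 + t ^ (2 * (⌊α⌋₊ + 1))) :=
        mul_le_mul_of_nonneg_left (by linarith) hc.le
    _ ≤ 1 + b * t ^ (2 * (⌊α⌋₊ + 1)) := by
        have h1 := min_le_left (1 / 2) b
        have h2 := mul_le_mul_of_nonneg_right (min_le_right (1 / 2) b) hT
        linarith
    _ ≤ q0 α t := hq
end

section
/- Let $\alpha > 0$ be a non-integer real number and let $a_0 = 1$, $a_k = \alpha(\alpha-1)\cdots(\alpha-k+1)/k!$ for $k \ge 1$. For each integer $j \ge 1$ define $q_j(t) = \tfrac{1}{2} a_{\lfloor\alpha\rfloor+2j-1}\, t^{2(\lfloor\alpha\rfloor+2j-1)} + a_{\lfloor\alpha\rfloor+2j}\, t^{2(\lfloor\alpha\rfloor+2j)} + \tfrac{1}{2} a_{\lfloor\alpha\rfloor+2j+1}\, t^{2(\lfloor\alpha\rfloor+2j+1)}$. Then $q_j(t) \ge 0$ for all real $t$, with $q_j(t) > 0$ for $t \ne 0$. 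-/
open Filter MeasureTheory

/-- For `j ≥ 1`,
`q_j(t) = (1/2) a_{⌊α⌋+2j-1} t^{2(⌊α⌋+2j-1)} + a_{⌊α⌋+2j} t^{2(⌊α⌋+2j)}
  + (1/2) a_{⌊α⌋+2j+1} t^{2(⌊α⌋+2j+1)}`. -/
noncomputable def qj (α : ℝ) (j : ℕ) (t : ℝ) : ℝ :=
  (1 / 2) * a α (⌊α⌋₊ + 2 * j - 1) * t ^ (2 * (⌊α⌋₊ + 2 * j - 1)) +
    a α (⌊α⌋₊ + 2 * j) * t ^ (2 * (⌊α⌋₊ + 2 * j)) +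
    (1 / 2) * a α (⌊α⌋₊ + 2 * j + 1) * t ^ (2 * (⌊α⌋₊ + 2 * j + 1))

/-- Recurrence for generalized binomial coefficients. -/
lemma a_succ (α : ℝ) (k : ℕ) : a α (k + 1) = a α k * ((α - k) / (k + 1)) := by
  have h : (Nat.factorial k : ℝ) ≠ 0 := by positivity
  have h' : (k : ℝ) + 1 ≠ 0 := by positivity
  simp only [a, Finset.prod_range_succ, Nat.factorial_succ, Nat.cast_mul, Nat.cast_succ]
  field_simp

/-- The coefficients of index `⌊α⌋ + 1, ⌊α⌋ + 3, …` are positive. -/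
lemma a_floor_add_odd_pos {α : ℝ} (hα0 : 0 < α) (hαni : ∀ n : ℤ, α ≠ (n : ℝ)) (i : ℕ) :
    0 < a α (⌊α⌋₊ + 2 * i + 1) := by
  induction i with
  | zero =>
    refine div_pos (Finset.prod_pos fun m hm => ?_) (by positivity)
    have hm' : m ≤ ⌊α⌋₊ := by simpa [Nat.lt_succ_iff] using hm
    have hle : (m : ℝ) ≤ α := (Nat.le_floor_iff hα0.le).1 hm'
    exact sub_pos.2 (hle.lt_of_ne fun h => hαni m (by simpa using h.symm))
  | succ i ih =>
    rw [show ⌊α⌋₊ + 2 * (i + 1) + 1 = ⌊α⌋₊ + 2 * i + 1 + 1 + 1 by ring, a_succ, a_succ, mul_assoc]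
    have hfl : α < ⌊α⌋₊ + 1 := Nat.lt_floor_add_one α
    have hi : (0 : ℝ) ≤ i := i.cast_nonneg
    refine mul_pos ih (mul_pos_of_neg_of_neg ?_ ?_) <;>
      refine div_neg_of_neg_of_pos ?_ (by positivity) <;> push_cast <;> linarith

/-- If `a α k > 0` and `k > α > -1`, the polynomial
`a_k t^(2k) / 2 + a_{k+1} t^(2(k+1)) + a_{k+2} t^(2(k+2)) / 2` is positive for `t ≠ 0`. -/
lemma three_term_pos {α : ℝ} (hα : -1 < α) {k : ℕ} (hk : α < k) (ha : 0 < a α k)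
    {t : ℝ} (ht : t ≠ 0) :
    0 < (1 / 2) * a α k * t ^ (2 * k) + a α (k + 1) * t ^ (2 * (k + 1)) +
      (1 / 2) * a α (k + 2) * t ^ (2 * (k + 2)) := by
  have hk1 : (0 : ℝ) < k + 1 := by positivity
  have hk2 : (0 : ℝ) < k + 2 := by positivity
  set p : ℝ := (k - α) / (k + 1) with hp
  set q : ℝ := (k + 1 - α) / (k + 2) with hq
  have hp0 : 0 < p := div_pos (sub_pos.2 hk) hk1
  have hpq : p < q := by
    rw [hp, hq, div_lt_div_iff₀ hk1 hk2]
    linarith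
  have h1 : a α (k + 1) = -(a α k * p) := by
    rw [a_succ, hp]
    ring
  have h2 : a α (k + 2) = a α k * p * q := by
    rw [a_succ, h1, hq]
    push_cast
    ring
  have key : (1 / 2) * a α k * t ^ (2 * k) + a α (k + 1) * t ^ (2 * (k + 1)) +
      (1 / 2) * a α (k + 2) * t ^ (2 * (k + 2)) =
      (1 / 2) * a α k * (t ^ k) ^ 2 * ((1 - p * t ^ 2) ^ 2 + p * (q - p) * (t ^ 2) ^ 2) := by
    rw [h1, h2]
    ring
  have hqp : 0 < q - p := sub_pos.2 hpq
  rw [key]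
  positivity

/-- For non-integer `α > 0` and `j ≥ 1`, the polynomial `q_j` is non-negative on `ℝ`
and strictly positive away from `0`. -/
theorem stmt_3 (α : ℝ) (hα0 : 0 < α) (hαni : ∀ n : ℤ, α ≠ (n : ℝ))
    (j : ℕ) (hj : 1 ≤ j) :
    (∀ t : ℝ, 0 ≤ qj α j t) ∧ (∀ t : ℝ, t ≠ 0 → 0 < qj α j t) := by
  have hpos : ∀ t : ℝ, t ≠ 0 → 0 < qj α j t := by
    intro t ht
    obtain ⟨i, rfl⟩ := Nat.exists_eq_add_of_le' hj
    have hk : α < ((⌊α⌋₊ + 2 * i + 1 : ℕ) : ℝ) := by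
      have hfl : α < ⌊α⌋₊ + 1 := Nat.lt_floor_add_one α
      have hi : (0 : ℝ) ≤ i := i.cast_nonneg
      push_cast
      linarith
    exact three_term_pos (by linarith) hk (a_floor_add_odd_pos hα0 hαni i) ht
  refine ⟨fun t => ?_, hpos⟩
  rcases eq_or_ne t 0 with rfl | ht
  · have h : ⌊α⌋₊ + 2 * j - 1 ≠ 0 := by omega
    have h' : j ≠ 0 := by omega
    simp [qj, h, h']
  · exact (hpos t ht).le
end

section
/- Let $\alpha > 0$ be a non-integer real number and let $a_0 = 1$, $a_k = \alpha(\alpha-1)\cdots(\alpha-k+1)/k!$ for $k \ge 1$. For $j \ge 1$, define the quadratic discriminant $D_j = 4\left(\frac{\alpha - \lfloor\alpha\rfloor - 2j + 1}{\lfloor\alpha\rfloor + 2j}\right)^2 - 4\,\frac{(\alpha - \lfloor\alpha\rfloor - 2j)(\alpha - \lfloor\alpha\rfloor - 2j + 1)}{(\lfloor\alpha\rfloor + 2j)(\lfloor\alpha\rfloor + 2j + 1)}$ associated to the quadratic factor of $q_j(\sqrt{t})$. Then $D_j < 0$ for every integer $j \ge 1$. -/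
open Filter MeasureTheory

/-- The discriminant of the quadratic factor of `q_j(√t)` is negative for every
integer `j ≥ 1` and non-integer `α > 0`. -/
theorem stmt_4 (α : ℝ) (hα0 : 0 < α) (hαni : ∀ n : ℤ, α ≠ (n : ℝ))
    (j : ℕ) (hj : 1 ≤ j) :
    4 * ((α - (⌊α⌋₊ : ℝ) - 2 * (j : ℝ) + 1) / ((⌊α⌋₊ : ℝ) + 2 * (j : ℝ))) ^ 2 -
        4 * ((α - (⌊α⌋₊ : ℝ) - 2 * (j : ℝ)) * (α - (⌊α⌋₊ : ℝ) - 2 * (j : ℝ) + 1)) /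
          (((⌊α⌋₊ : ℝ) + 2 * (j : ℝ)) * ((⌊α⌋₊ : ℝ) + 2 * (j : ℝ) + 1)) < 0 := by
  have hfloor : α < (⌊α⌋₊ : ℝ) + 1 := Nat.lt_floor_add_one α
  have hj' : (1 : ℝ) ≤ (j : ℝ) := by exact_mod_cast hj
  have hn : (0 : ℝ) ≤ (⌊α⌋₊ : ℝ) := Nat.cast_nonneg _
  have hN : 0 < (⌊α⌋₊ : ℝ) + 2 * (j : ℝ) := by linarith
  have hu : α - (⌊α⌋₊ : ℝ) - 2 * (j : ℝ) + 1 < 0 := by linarith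
  generalize (⌊α⌋₊ : ℝ) = n at *
  have key : 4 * ((α - n - 2 * (j : ℝ) + 1) / (n + 2 * (j : ℝ))) ^ 2 -
        4 * ((α - n - 2 * (j : ℝ)) * (α - n - 2 * (j : ℝ) + 1)) /
          ((n + 2 * (j : ℝ)) * (n + 2 * (j : ℝ) + 1)) =
      4 * ((α - n - 2 * (j : ℝ) + 1) * (α + 1)) /
        ((n + 2 * (j : ℝ)) ^ 2 * (n + 2 * (j : ℝ) + 1)) := by
    have hN1 : n + 2 * (j : ℝ) + 1 ≠ 0 := by positivity
    field_simp
    ring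
  rw [key]
  have hnum : (α - n - 2 * (j : ℝ) + 1) * (α + 1) < 0 :=
    mul_neg_of_neg_of_pos hu (by linarith)
  exact div_neg_of_neg_of_pos (by linarith) (by positivity)
end

section
/- Let $d \ge 1$, let $\alpha > d/2$ be a non-integer real number, $\kappa > 0$, $a_0 = 1$, $a_k = \alpha(\alpha-1)\cdots(\alpha-k+1)/k!$ for $k \ge 1$, and $K = \lfloor\alpha\rfloor + 2J + 1$ for an integer $J \ge 1$. Then there exists a constant $c > 0$, independent of $h$, such that for all $h > 0$ and all $\xi \in \left(-\frac{\pi}{h}, \frac{\pi}{h}\right)^d$, $\sum_{k=0}^{K} a_k\, \kappa^{2(\alpha-k)} \left( \sum_{p=1}^{d} h^{-2}\,(2 - 2\cos(h\,\xi_p)) \right)^{k} \ge c\,(1 + |\xi|^{d+2})$. -/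
open Filter MeasureTheory

/-- The product `α (α-1) ⋯ (α-k+1)` has the sign `(-1)^n` for `k = ⌊α⌋ + 1 + n`. -/
lemma neg_one_pow_mul_prod_sub_pos {α : ℝ} (h0 : 0 ≤ α) (hni : ∀ n : ℤ, α ≠ (n : ℝ)) (n : ℕ) :
    0 < (-1 : ℝ) ^ n * ∏ i ∈ Finset.range (⌊α⌋₊ + 1 + n), (α - i) := by
  induction n with
  | zero =>
    simp only [pow_zero, one_mul, add_zero]
    refine Finset.prod_pos fun i hi => sub_pos.2 ?_
    have hle : (i : ℝ) ≤ α :=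
      (Nat.cast_le.2 (Nat.lt_succ_iff.1 (Finset.mem_range.1 hi))).trans (Nat.floor_le h0)
    exact lt_of_le_of_ne hle fun h => hni i (by simp [h])
  | succ n ih =>
    rw [← add_assoc, Finset.prod_range_succ, pow_succ]
    have hlt : α < ((⌊α⌋₊ + 1 + n : ℕ) : ℝ) := by
      push_cast
      linarith [Nat.lt_floor_add_one α, n.cast_nonneg (α := ℝ)]
    nlinarith [mul_pos ih (sub_pos.2 hlt)]

lemma prod_range_succ_sub (β : ℝ) (k : ℕ) :
    ∏ i ∈ Finset.range (k + 1), (β - i) = β * ∏ i ∈ Finset.range k, (β - 1 - i) := by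
  rw [Finset.prod_range_succ', mul_comm]
  push_cast
  congr 1
  · simp
  · exact Finset.prod_congr rfl fun i _ => by ring

lemma a_succ_mul (β : ℝ) (k : ℕ) : a β (k + 1) * (k + 1) = β * a (β - 1) k := by
  have hk : (k.factorial : ℝ) ≠ 0 := by positivity
  have hk1 : (k : ℝ) + 1 ≠ 0 := by positivity
  simp only [a, prod_range_succ_sub, Nat.factorial_succ]
  push_cast
  field_simp

lemma hasDerivAt_binomial_sum (β : ℝ) (n : ℕ) (x : ℝ) :
    HasDerivAt (fun y => ∑ k ∈ Finset.range (n + 2), a β k * y ^ k)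
      (β * ∑ k ∈ Finset.range (n + 1), a (β - 1) k * x ^ k) x := by
  have h := HasDerivAt.fun_sum (u := Finset.range (n + 2))
    fun k _ => (hasDerivAt_pow k x).const_mul (a β k)
  refine h.congr_deriv ?_
  rw [Finset.mul_sum, Finset.sum_range_succ']
  simp only [Nat.cast_zero, zero_mul, mul_zero, add_zero]
  refine Finset.sum_congr rfl fun k _ => ?_
  rw [← mul_assoc β, ← a_succ_mul]
  push_cast
  ring

/-- The error of the binomial Taylor polynomial of `(1 + x)^β` at `x ≥ 0` has the sign of the
first omitted coefficient. -/
lemma prod_sub_mul_binomial_error_nonpos (n : ℕ) : ∀ (β : ℝ) {x : ℝ}, 0 ≤ x →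
    (∏ i ∈ Finset.range (n + 1), (β - i)) *
      (∑ k ∈ Finset.range (n + 1), a β k * x ^ k - (1 + x) ^ β) ≤ 0 := by
  induction n with
  | zero =>
    intro β x hx
    simp only [zero_add, Finset.prod_range_one, Finset.sum_range_one, a_zero, Nat.cast_zero,
      sub_zero, pow_zero, mul_one]
    rcases le_total 0 β with hβ | hβ
    · exact mul_nonpos_of_nonneg_of_nonpos hβ
        (sub_nonpos.2 (Real.one_le_rpow (by linarith) hβ))
    · exact mul_nonpos_of_nonpos_of_nonneg hβ
        (sub_nonneg.2 (Real.rpow_le_one_of_one_le_of_nonpos (by linarith) hβ))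
  | succ n ih =>
    intro β x hx
    set F : ℝ → ℝ := fun y => (∏ i ∈ Finset.range (n + 1 + 1), (β - i)) *
      (∑ k ∈ Finset.range (n + 1 + 1), a β k * y ^ k - (1 + y) ^ β) with hF
    have hder : ∀ y : ℝ, 0 ≤ y → HasDerivAt F
        ((∏ i ∈ Finset.range (n + 1 + 1), (β - i)) *
          (β * ∑ k ∈ Finset.range (n + 1), a (β - 1) k * y ^ k - β * (1 + y) ^ (β - 1))) y := by
      intro y hy
      have h1 : HasDerivAt (fun y : ℝ => (1 + y) ^ β) (β * (1 + y) ^ (β - 1)) y := by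
        have h2 := ((hasDerivAt_id y).const_add 1).rpow_const (p := β)
          (Or.inl (by simp only [id]; positivity))
        simpa using h2
      exact ((hasDerivAt_binomial_sum β n y).sub h1).const_mul _
    have hanti : AntitoneOn F (Set.Ici 0) := by
      refine antitoneOn_of_deriv_nonpos (convex_Ici 0)
        (fun y hy => (hder y hy).continuousAt.continuousWithinAt)
        (fun y hy => (hder y (interior_subset hy)).differentiableAt.differentiableWithinAt)
        fun y hy => ?_
      have hy0 : 0 ≤ y := interior_subset hy
      rw [(hder y hy0).deriv, prod_range_succ_sub]
      nlinarith [mul_nonpos_of_nonneg_of_nonpos (sq_nonneg β) (ih (β - 1) hy0)]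
    have hzero : F 0 = 0 := by
      simp [hF, Finset.sum_range_succ', a_zero]
    exact hzero ▸ hanti Set.self_mem_Ici hx hx

/-- For `x ≥ 0`, a polynomial with positive leading coefficient which is at least `1` dominates
a multiple of `1 + x^K`. -/
lemma exists_mul_one_add_pow_le (b : ℕ → ℝ) (K : ℕ) (hK : 0 < b K)
    (hone : ∀ x : ℝ, 0 ≤ x → 1 ≤ ∑ k ∈ Finset.range (K + 1), b k * x ^ k) :
    ∃ c : ℝ, 0 < c ∧ ∀ x : ℝ, 0 ≤ x →
      c * (1 + x ^ K) ≤ ∑ k ∈ Finset.range (K + 1), b k * x ^ k := by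
  set A : ℝ := ∑ k ∈ Finset.range K, |b k| with hA
  have hA0 : 0 ≤ A := Finset.sum_nonneg fun _ _ => abs_nonneg _
  set M : ℝ := 1 + 2 * A / b K with hM
  have hM1 : 1 ≤ M := by rw [hM]; linarith [show 0 ≤ 2 * A / b K by positivity]
  have hMK : 0 < M ^ K := by positivity
  have hlarge : ∀ x : ℝ, M ≤ x → b K / 2 * x ^ K ≤ ∑ k ∈ Finset.range (K + 1), b k * x ^ k := by
    intro x hx
    have hx1 : 1 ≤ x := hM1.trans hx
    have hlow : ∀ k ∈ Finset.range K, -(|b k| * (x ^ K / x)) ≤ b k * x ^ k := by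
      intro k hk
      have hpow : x ^ k ≤ x ^ K / x := by
        rw [le_div_iff₀ (by linarith), ← pow_succ]
        exact pow_le_pow_right₀ hx1 (Finset.mem_range.1 hk)
      have hxk : 0 ≤ x ^ k := by positivity
      nlinarith [neg_abs_le (b k), abs_nonneg (b k),
        mul_le_mul_of_nonneg_left hpow (abs_nonneg (b k)),
        mul_le_mul_of_nonneg_right (neg_abs_le (b k)) hxk]
    have hsum := Finset.sum_le_sum hlow
    rw [Finset.sum_neg_distrib, ← Finset.sum_mul, ← hA] at hsum
    have hAx : A * (x ^ K / x) ≤ b K / 2 * x ^ K := by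
      have hle : A ≤ b K / 2 * x := by
        have h2 : 2 * A / b K ≤ x := by linarith
        rw [div_le_iff₀ hK] at h2
        linarith
      rw [← mul_div_assoc, div_le_iff₀ (by linarith)]
      nlinarith [mul_le_mul_of_nonneg_right hle (show 0 ≤ x ^ K by positivity)]
    rw [Finset.sum_range_succ]
    linarith
  set c : ℝ := min (b K / 2) (M ^ K)⁻¹ with hc
  have hcpos : 0 < c := lt_min (by positivity) (by positivity)
  have htop : ∀ x : ℝ, 0 ≤ x → c * x ^ K ≤ ∑ k ∈ Finset.range (K + 1), b k * x ^ k := by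
    intro x hx
    have hxK : 0 ≤ x ^ K := by positivity
    rcases le_total M x with h | h
    · exact (mul_le_mul_of_nonneg_right (min_le_left _ _) hxK).trans (hlarge x h)
    · refine le_trans ?_ (hone x hx)
      calc c * x ^ K ≤ (M ^ K)⁻¹ * M ^ K :=
            mul_le_mul (min_le_right _ _) (pow_le_pow_left₀ hx h K) hxK (by positivity)
        _ = 1 := inv_mul_cancel₀ hMK.ne'
  refine ⟨min 1 c / 2, by positivity, fun x hx => ?_⟩
  have hxK : 0 ≤ x ^ K := by positivity
  nlinarith [hone x hx, htop x hx, min_le_left 1 c,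
    mul_le_mul_of_nonneg_right (min_le_right 1 c) hxK]

/-- The symbol of the discrete Laplacian is comparable to `|ξ|²` on the Brillouin zone. -/
lemma norm_sq_le_discrete_laplacian_symbol {d : ℕ} {h : ℝ} (hh : 0 < h)
    (ξ : EuclideanSpace ℝ (Fin d))
    (hξ : ∀ p : Fin d, ξ p ∈ Set.Ioo (-(Real.pi / h)) (Real.pi / h)) :
    4 / Real.pi ^ 2 * ‖ξ‖ ^ 2 ≤ ∑ p : Fin d, h⁻¹ ^ 2 * (2 - 2 * Real.cos (h * ξ p)) := by
  rw [EuclideanSpace.real_norm_sq_eq, Finset.mul_sum]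
  refine Finset.sum_le_sum fun p _ => ?_
  have habs : |h * ξ p| ≤ Real.pi := by
    rw [abs_mul, abs_of_pos hh, mul_comm, ← le_div_iff₀ hh]
    exact abs_le.2 ⟨(hξ p).1.le, (hξ p).2.le⟩
  have hcos := Real.cos_le_one_sub_mul_cos_sq habs
  calc 4 / Real.pi ^ 2 * ξ p ^ 2
      = h⁻¹ ^ 2 * (2 - 2 * (1 - 2 / Real.pi ^ 2 * (h * ξ p) ^ 2)) := by
        field_simp
        ring
    _ ≤ h⁻¹ ^ 2 * (2 - 2 * Real.cos (h * ξ p)) := by gcongr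

/-- Uniform-in-`h` lower bound for the discrete spectral denominator: for
non-integer `α > d/2`, `κ > 0` and `K = ⌊α⌋ + 2J + 1` there is a `c > 0`,
independent of `h`, with
`∑_{k=0}^K a_k κ^{2(α-k)} (∑_p h^{-2}(2 - 2cos(h ξ_p)))^k ≥ c (1 + |ξ|^{d+2})`
for all `h > 0` and all `ξ ∈ (-π/h, π/h)^d`. -/
theorem stmt_15 (d : ℕ) (hd : 1 ≤ d) (α : ℝ) (hα : (d : ℝ) / 2 < α)
    (hαni : ∀ n : ℤ, α ≠ (n : ℝ)) (κ : ℝ) (hκ : 0 < κ) (J : ℕ) (hJ : 1 ≤ J) :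
    ∃ c : ℝ, 0 < c ∧ ∀ h : ℝ, 0 < h → ∀ ξ : EuclideanSpace ℝ (Fin d),
      (∀ p : Fin d, ξ p ∈ Set.Ioo (-(Real.pi / h)) (Real.pi / h)) →
      c * (1 + ‖ξ‖ ^ (d + 2)) ≤
        ∑ k ∈ Finset.range (⌊α⌋₊ + 2 * J + 1 + 1),
          a α k * κ ^ (2 * (α - (k : ℝ))) *
            (∑ p : Fin d, h⁻¹ ^ 2 * (2 - 2 * Real.cos (h * ξ p))) ^ k := by
  have hα0 : 0 < α := lt_of_le_of_lt (by positivity) hα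
  set K := ⌊α⌋₊ + 2 * J + 1 with hK
  have hKpos : 0 < a α K := by
    have h := neg_one_pow_mul_prod_sub_pos hα0.le hαni (2 * J)
    rw [pow_mul, neg_one_sq, one_pow, one_mul, add_right_comm] at h
    exact div_pos h (by positivity)
  have hone : ∀ x : ℝ, 0 ≤ x → 1 ≤ ∑ k ∈ Finset.range (K + 1), a α k * x ^ k := by
    intro x hx
    have hneg := neg_one_pow_mul_prod_sub_pos hα0.le hαni (2 * J + 1)
    rw [pow_succ, pow_mul, neg_one_sq, one_pow, one_mul, neg_one_mul,
      show ⌊α⌋₊ + 1 + (2 * J + 1) = K + 1 by omega] at hneg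
    have herr := prod_sub_mul_binomial_error_nonpos K α hx
    have hge := nonneg_of_mul_nonpos_right herr (by linarith)
    linarith [Real.one_le_rpow (show 1 ≤ 1 + x by linarith) hα0.le]
  obtain ⟨c, hc, hbound⟩ := exists_mul_one_add_pow_le (a α) K hKpos hone
  set γ : ℝ := 4 / Real.pi ^ 2 / κ ^ 2 with hγ
  have hγ0 : 0 < γ := by positivity
  have hγK : 0 < γ ^ K := by positivity
  have hdK : d + 2 ≤ 2 * K := by
    have h1 : (d : ℝ) < 2 * (⌊α⌋₊ + 1) := by linarith [Nat.lt_floor_add_one α]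
    have h2 : d < 2 * (⌊α⌋₊ + 1) := by exact_mod_cast h1
    omega
  refine ⟨κ ^ (2 * α) * (c / (2 + (γ ^ K)⁻¹)), by positivity, fun h hh ξ hξ => ?_⟩
  set L := ∑ p : Fin d, h⁻¹ ^ 2 * (2 - 2 * Real.cos (h * ξ p)) with hL
  have hLlow := norm_sq_le_discrete_laplacian_symbol hh ξ hξ
  have hxlow : γ * ‖ξ‖ ^ 2 ≤ L / κ ^ 2 := by
    rw [hγ, div_mul_eq_mul_div]
    gcongr
  have hx0 : 0 ≤ L / κ ^ 2 := le_trans (by positivity) hxlow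
  have hsum : ∑ k ∈ Finset.range (K + 1), a α k * κ ^ (2 * (α - (k : ℝ))) * L ^ k =
      κ ^ (2 * α) * ∑ k ∈ Finset.range (K + 1), a α k * (L / κ ^ 2) ^ k := by
    rw [Finset.mul_sum]
    refine Finset.sum_congr rfl fun k _ => ?_
    rw [mul_sub, Real.rpow_sub hκ, div_pow, ← pow_mul, ← Real.rpow_natCast κ (2 * k)]
    push_cast
    ring
  rw [hsum, mul_assoc]
  refine mul_le_mul_of_nonneg_left (le_trans ?_ (hbound _ hx0)) (by positivity)
  rw [div_mul_eq_mul_div, div_le_iff₀ (by positivity), mul_assoc]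
  refine mul_le_mul_of_nonneg_left ?_ hc.le
  have hr : ‖ξ‖ ^ (d + 2) ≤ 1 + ‖ξ‖ ^ (2 * K) := by
    rcases le_total ‖ξ‖ 1 with h1 | h1
    · linarith [pow_le_one₀ (n := d + 2) (norm_nonneg ξ) h1,
        pow_nonneg (norm_nonneg ξ) (2 * K)]
    · linarith [pow_le_pow_right₀ h1 hdK]
  have hrK : ‖ξ‖ ^ (2 * K) ≤ (γ ^ K)⁻¹ * (L / κ ^ 2) ^ K := by
    rw [inv_mul_eq_div, le_div_iff₀ hγK, pow_mul, ← mul_pow, mul_comm]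
    exact pow_le_pow_left₀ (by positivity) hxlow K
  nlinarith [pow_nonneg hx0 K, inv_pos.2 hγK]
end
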